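/- (Character-space decomposition for the non-split torus: simple spectrum) Suppose p ≡ 3 (mod 4), so the centralizer T_w of w = [[0,1],[−1,0]] in SL(2, ZMod p) is cyclic of order p + 1. Let t be any generator of T_w. Then det(t − I) ≠ 0, so the kernel-formula operator ρ(t) = p⁻¹ · σ(−det(κ(t) + I)) · Σ_{v ∈ (ZMod p)²} ψ(4⁻¹·ω(κ(t)·v, v)) · π(v, 0), κ(t) = (t + I)(t − I)⁻¹, is defined, and ρ(t) is diagonalizable with p distinct eigenvalues; equivalently, every eigenspace of ρ(t) is one-dimensional and the eigenspaces span ℂ(ZMod p). -/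

import Mathlib

open scoped BigOperators

noncomputable section

namespace DFTWeil

open scoped Classical

/-- Multiplication of the Heisenberg group `H = (V × V) × Z`,
`(v,z)·(v',z') = (v+v', z+z'+2⁻¹ ω(v,v'))` with `ω((t,w),(t',w')) = t w' - w t'`. -/
def hMul {p : ℕ} (a b : (ZMod p × ZMod p) × ZMod p) : (ZMod p × ZMod p) × ZMod p :=
  (a.1 + b.1, a.2 + b.2 + (2 : ZMod p)⁻¹ * (a.1.1 * b.1.2 - a.1.2 * b.1.1))

/-- The additive character `ψ(z) = exp(2πi z/p)`. -/
def psi (p : ℕ) (z : ZMod p) : ℂ :=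
  Complex.exp (2 * Real.pi * Complex.I * (z.val : ℂ) / p)

/-- The standard realization of the Heisenberg representation:
`(π((t,w),z) f)(x) = ψ(z + 2⁻¹ t w + w x) f(x+t)`. -/
def heis (p : ℕ) (h : (ZMod p × ZMod p) × ZMod p) :
    (ZMod p → ℂ) →ₗ[ℂ] (ZMod p → ℂ) where
  toFun f x := psi p (h.2 + (2 : ZMod p)⁻¹ * h.1.1 * h.1.2 + h.1.2 * x) * f (x + h.1.1)
  map_add' f g := by funext x; simp [mul_add]
  map_smul' c f := by funext x; simp [Pi.smul_apply, smul_eq_mul]; ring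

/-- The Legendre character `σ` of `ZMod p` (extended by `0` at `0`). -/
def sgm (p : ℕ) (a : ZMod p) : ℂ := if a = 0 then 0 else if IsSquare a then 1 else -1

/-- Action of a `2 × 2` matrix on a column vector `v ∈ (ZMod p)²`. -/
def matVec {p : ℕ} (m : Matrix (Fin 2) (Fin 2) (ZMod p)) (v : ZMod p × ZMod p) :
    ZMod p × ZMod p :=
  (m 0 0 * v.1 + m 0 1 * v.2, m 1 0 * v.1 + m 1 1 * v.2)

/-- The symplectic form `ω((t,w),(t',w')) = t w' - w t'`. -/
def omg {p : ℕ} (v w : ZMod p × ZMod p) : ZMod p := v.1 * w.2 - v.2 * w.1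

/-- The Cayley transform `κ(g) = (g+I)(g-I)⁻¹`. -/
def cayley {p : ℕ} (g : Matrix (Fin 2) (Fin 2) (ZMod p)) : Matrix (Fin 2) (Fin 2) (ZMod p) :=
  (g + 1) * (g - 1)⁻¹

/-- The Weil operator given by the kernel formula
`ρ(g) = p⁻¹ σ(-det(κ(g)+I)) Σ_v ψ(4⁻¹ ω(κ(g)v,v)) π(v,0)`. -/
def weilOp (p : ℕ) [Fact p.Prime] (g : Matrix (Fin 2) (Fin 2) (ZMod p)) :
    (ZMod p → ℂ) →ₗ[ℂ] (ZMod p → ℂ) :=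
  (p : ℂ)⁻¹ • sgm p (-((cayley g + 1).det)) •
    ∑ v : ZMod p × ZMod p,
      psi p ((4 : ZMod p)⁻¹ * omg (matVec (cayley g) v) v) • heis p (v, 0)

/-- The Weyl element `w = [[0,1],[-1,0]]` as an element of `SL(2, ZMod p)`. -/
def wS (p : ℕ) [Fact p.Prime] : Matrix.SpecialLinearGroup (Fin 2) (ZMod p) :=
  ⟨!![0, 1; -1, 0], by simp [Matrix.det_fin_two_of]⟩

section AdditiveCharacter

variable {p : ℕ}

theorem psi_ne_zero (a : ZMod p) : psi p a ≠ 0 := Complex.exp_ne_zero _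

variable [Fact p.Prime]

theorem psi_eq_stdAddChar (z : ZMod p) : psi p z = ZMod.stdAddChar z := by
  rw [ZMod.stdAddChar_apply, ZMod.toCircle_apply, psi]

theorem psi_zero : psi p 0 = 1 := by
  simp [psi_eq_stdAddChar]

theorem psi_add (a b : ZMod p) : psi p (a + b) = psi p a * psi p b := by
  simp [psi_eq_stdAddChar, AddChar.map_add_eq_mul]

theorem psi_eq_one_iff (a : ZMod p) : psi p a = 1 ↔ a = 0 := by
  rw [psi_eq_stdAddChar, ← AddChar.map_zero_eq_one (ZMod.stdAddChar (N := p)),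
    ZMod.injective_stdAddChar.eq_iff]

theorem sum_psi_mul (b : ZMod p) : ∑ x : ZMod p, psi p (x * b) = if b = 0 then (p : ℂ) else 0 := by
  simp_rw [psi_eq_stdAddChar]
  rw [AddChar.sum_mulShift b (ZMod.isPrimitive_stdAddChar p), ZMod.card]
  split_ifs <;> simp

/-- Fourier inversion on `ZMod p`, as injectivity of the transform. -/
theorem eq_zero_of_sum_psi_mul_eq_zero {F : ZMod p → ℂ}
    (hF : ∀ w, ∑ x, psi p (w * x) * F x = 0) : F = 0 := by
  funext x₀
  have h : ∑ w, psi p (w * -x₀) * ∑ x, psi p (w * x) * F x = p * F x₀ := by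
    simp_rw [Finset.mul_sum]
    rw [Finset.sum_comm]
    have : ∀ x, ∑ w, psi p (w * -x₀) * (psi p (w * x) * F x)
        = if x = x₀ then (p : ℂ) * F x else 0 := by
      intro x
      simp_rw [← mul_assoc, ← psi_add, ← mul_add, ← Finset.sum_mul, sum_psi_mul,
        neg_add_eq_zero, eq_comm (a := x₀)]
      split_ifs <;> simp
    simp_rw [this]
    simp
  simp_rw [hF] at h
  have hp : (p : ℂ) ≠ 0 := Nat.cast_ne_zero.2 (Fact.out : p.Prime).ne_zero
  simpa [hp, eq_comm] using h

end AdditiveCharacter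

section Heisenberg

variable {p : ℕ} [Fact p.Prime]

theorem heis_apply (v : ZMod p × ZMod p) (f : ZMod p → ℂ) (x : ZMod p) :
    heis p (v, 0) f x = psi p ((2 : ZMod p)⁻¹ * v.1 * v.2 + v.2 * x) * f (x + v.1) := by
  simp [heis]

theorem heis_mul (h2 : (2 : ZMod p) ≠ 0) (u v : ZMod p × ZMod p) :
    heis p (u, 0) * heis p (v, 0) = psi p ((2 : ZMod p)⁻¹ * omg u v) • heis p (u + v, 0) := by
  refine LinearMap.ext fun f ↦ funext fun x ↦ ?_
  simp only [Module.End.mul_apply, LinearMap.smul_apply, Pi.smul_apply, smul_eq_mul, heis_apply,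
    ← mul_assoc, ← psi_add, omg, Prod.fst_add, Prod.snd_add]
  have h : (2 : ZMod p) * 2⁻¹ = 1 := mul_inv_cancel₀ h2
  congr 2
  · linear_combination (-u.1 * v.2) * h
  · ring

/-- The transpose of `π(t, w)` is `π(-t, w)`. -/
theorem dotProduct_heis (h2 : (2 : ZMod p) ≠ 0) (v : ZMod p × ZMod p) (f g : ZMod p → ℂ) :
    g ⬝ᵥ heis p (v, 0) f = heis p ((-v.1, v.2), 0) g ⬝ᵥ f := by
  simp only [dotProduct, heis_apply]
  rw [← Equiv.sum_comp (Equiv.subRight v.1)]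
  refine Finset.sum_congr rfl fun x _ ↦ ?_
  have h : (2 : ZMod p) * 2⁻¹ = 1 := mul_inv_cancel₀ h2
  have e : (2 : ZMod p)⁻¹ * v.1 * v.2 + v.2 * (x - v.1)
      = (2 : ZMod p)⁻¹ * -v.1 * v.2 + v.2 * x := by
    linear_combination (v.1 * v.2) * h
  simp only [Equiv.subRight_apply, sub_add_cancel, e, ← sub_eq_add_neg]
  ring

/-- The matrix coefficients of `f ⊗ g` against the Heisenberg operators determine `f ⊗ g`. -/
theorem mul_eq_mul_of_dotProduct_heis {f g f' g' : ZMod p → ℂ}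
    (h : ∀ v, g ⬝ᵥ heis p (v, 0) f = g' ⬝ᵥ heis p (v, 0) f') (x y : ZMod p) :
    g x * f y = g' x * f' y := by
  have key : (fun z ↦ g z * f (z + (y - x)) - g' z * f' (z + (y - x))) = 0 := by
    refine eq_zero_of_sum_psi_mul_eq_zero fun w ↦ ?_
    have hw := h (y - x, w)
    simp only [dotProduct, heis_apply, psi_add] at hw
    rw [← sub_eq_zero, ← Finset.sum_sub_distrib] at hw
    refine (mul_eq_zero.1 ?_).resolve_left (psi_ne_zero ((2 : ZMod p)⁻¹ * (y - x) * w))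
    rw [← hw, Finset.mul_sum]
    exact Finset.sum_congr rfl fun z _ ↦ by ring
  simpa [sub_eq_zero] using congrFun key x

/-- Schur's lemma for the Heisenberg representation. -/
theorem eq_smul_one_of_commute_heis (A : Module.End ℂ (ZMod p → ℂ))
    (hA : ∀ v, Commute A (heis p (v, 0))) : ∃ c : ℂ, A = c • 1 := by
  have hshift : ∀ x : ZMod p,
      heis p ((-x, 0), 0) (Pi.single 0 1) = (Pi.single x 1 : ZMod p → ℂ) := by
    intro x
    funext y
    simp [heis_apply, psi_zero, Pi.single_apply, add_neg_eq_zero]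
  have hmod : heis p ((0, 1), 0) (Pi.single 0 1) = (Pi.single 0 1 : ZMod p → ℂ) := by
    funext y
    by_cases hy : y = 0 <;> simp [heis_apply, psi_zero, hy]
  have happ : ∀ v f, A (heis p (v, 0) f) = heis p (v, 0) (A f) := fun v f ↦
    LinearMap.congr_fun (hA v) f
  have h0 : A (Pi.single 0 1) = A (Pi.single 0 1) 0 • Pi.single 0 1 := by
    funext y
    by_cases hy : y = 0
    · simp [hy]
    · have h := congrFun (happ (0, 1) (Pi.single 0 1)) y
      rw [hmod] at h
      simp only [heis_apply, mul_zero, zero_mul, zero_add, one_mul, add_zero] at h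
      have hy' : psi p y - 1 ≠ 0 := sub_ne_zero.2 fun e ↦ hy ((psi_eq_one_iff y).1 e)
      have : (psi p y - 1) * A (Pi.single 0 1) y = 0 := by linear_combination -h
      simpa [hy, hy'] using this
  refine ⟨A (Pi.single 0 1) 0, LinearMap.pi_ext' fun x ↦ LinearMap.ext_ring ?_⟩
  simp only [LinearMap.comp_apply, LinearMap.coe_single, LinearMap.smul_apply,
    Module.End.one_apply]
  rw [← hshift x, happ, h0]
  simp

/-- A nonzero operator intertwining the Heisenberg operators up to a reindexing is injective. -/
theorem injective_of_intertwine {A : Module.End ℂ (ZMod p → ℂ)} (hA0 : A ≠ 0)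
    {τ : ZMod p × ZMod p → ZMod p × ZMod p}
    (hA : ∀ v, A * heis p (v, 0) = heis p (τ v, 0) * A) {f : ZMod p → ℂ} (hf : A f = 0) :
    f = 0 := by
  by_contra hne
  obtain ⟨x₀, hx₀⟩ := Function.ne_iff.1 hne
  have hker : ∀ v, A (heis p (v, 0) f) = 0 := by
    intro v
    rw [← Module.End.mul_apply, hA, Module.End.mul_apply, hf, map_zero]
  refine hA0 (LinearMap.pi_ext' fun y ↦ LinearMap.ext_ring ?_)
  simp only [LinearMap.comp_apply, LinearMap.coe_single, LinearMap.zero_apply]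
  have hdelta : (Pi.single y (p * f x₀) : ZMod p → ℂ)
      = ∑ w, psi p (w * -y - (2 : ZMod p)⁻¹ * (x₀ - y) * w) • heis p ((x₀ - y, w), 0) f := by
    funext x
    simp only [Finset.sum_apply, Pi.smul_apply, heis_apply, smul_eq_mul, ← mul_assoc, ← psi_add]
    have e : ∀ w, w * -y - (2 : ZMod p)⁻¹ * (x₀ - y) * w + ((2 : ZMod p)⁻¹ * (x₀ - y) * w + w * x)
        = w * (x - y) := fun w ↦ by ring
    simp_rw [e, ← Finset.sum_mul, sum_psi_mul, sub_eq_zero]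
    by_cases hxy : x = y
    · simp [hxy]
    · simp [hxy]
  have hp : (p : ℂ) * f x₀ ≠ 0 :=
    mul_ne_zero (Nat.cast_ne_zero.2 (Fact.out : p.Prime).ne_zero) hx₀
  have hz : A (Pi.single y (p * f x₀)) = 0 := by
    rw [hdelta, map_sum]
    exact Finset.sum_eq_zero fun w _ ↦ by rw [map_smul, hker, smul_zero]
  have hs : (Pi.single y (p * f x₀) : ZMod p → ℂ) = (p * f x₀) • Pi.single y 1 := by
    rw [← Pi.single_smul, smul_eq_mul, mul_one]
  rw [hs, map_smul] at hz
  exact (smul_eq_zero.1 hz).resolve_left hp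

end Heisenberg

section GaussianOperator

variable {p : ℕ} [Fact p.Prime]

/-- The operator `Σ_v ψ(s (v₁² + v₂²)) π(v, 0)`. -/
def gaussOp (p : ℕ) [Fact p.Prime] (s : ZMod p) : Module.End ℂ (ZMod p → ℂ) :=
  ∑ v : ZMod p × ZMod p, psi p (s * (v.1 ^ 2 + v.2 ^ 2)) • heis p (v, 0)

theorem gaussOp_ne_zero (s : ZMod p) : gaussOp p s ≠ 0 := by
  intro h
  have hp : (p : ℂ) ≠ 0 := Nat.cast_ne_zero.2 (Fact.out : p.Prime).ne_zero
  have htr : ∑ x, gaussOp p s (Pi.single x 1) x = p := by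
    simp only [gaussOp, LinearMap.sum_apply, LinearMap.smul_apply, Finset.sum_apply,
      Pi.smul_apply, heis_apply, smul_eq_mul]
    rw [Finset.sum_comm, Fintype.sum_prod_type, Finset.sum_eq_single 0, Finset.sum_eq_single 0]
    · simp [psi_zero]
    · intro w _ hw
      simp_rw [← Finset.mul_sum]
      have := sum_psi_mul w
      simp_all [mul_comm]
    · simp
    · intro t _ ht
      simp [ht]
    · simp
  simp [h, hp, eq_comm] at htr

theorem dotProduct_gaussOp (h2 : (2 : ZMod p) ≠ 0) (s : ZMod p) (f g : ZMod p → ℂ) :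
    g ⬝ᵥ gaussOp p s f = gaussOp p s g ⬝ᵥ f := by
  simp only [gaussOp, LinearMap.sum_apply, LinearMap.smul_apply, dotProduct_sum, sum_dotProduct,
    dotProduct_smul, smul_dotProduct, dotProduct_heis h2]
  rw [← Equiv.sum_comp ((Equiv.neg (ZMod p)).prodCongr (Equiv.refl (ZMod p)))]
  simp

theorem gaussOp_mul_heis (h2 : (2 : ZMod p) ≠ 0) {s : ZMod p} {v v' : ZMod p × ZMod p}
    (h : ∀ y : ZMod p × ZMod p,
      s * ((y - v).1 ^ 2 + (y - v).2 ^ 2) + (2 : ZMod p)⁻¹ * omg (y - v) v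
        = s * ((y - v').1 ^ 2 + (y - v').2 ^ 2) + (2 : ZMod p)⁻¹ * omg v' (y - v')) :
    gaussOp p s * heis p (v, 0) = heis p (v', 0) * gaussOp p s := by
  simp only [gaussOp, Finset.sum_mul, Finset.mul_sum, smul_mul_assoc, mul_smul_comm, heis_mul h2,
    smul_smul, ← psi_add]
  refine (Equiv.sum_comp (Equiv.subRight v) _).symm.trans
    (.trans (Finset.sum_congr rfl fun y _ ↦ ?_) (Equiv.sum_comp (Equiv.subRight v') _))
  simp only [Equiv.subRight_apply, sub_add_cancel, add_sub_cancel, h y]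

end GaussianOperator

section Torus

variable {p : ℕ}

theorem matVec_one (v : ZMod p × ZMod p) : matVec 1 v = v := by
  simp [matVec]

theorem matVec_mul (m n : Matrix (Fin 2) (Fin 2) (ZMod p)) (v : ZMod p × ZMod p) :
    matVec (m * n) v = matVec m (matVec n v) := by
  simp only [matVec, Matrix.mul_apply, Fin.sum_univ_two]
  ext <;> simp only <;> ring

variable [Fact p.Prime]

theorem mem_centralizer_wS_iff (g : Matrix.SpecialLinearGroup (Fin 2) (ZMod p)) :
    g ∈ Subgroup.centralizer {wS p} ↔ g 1 1 = g 0 0 ∧ g 1 0 = -g 0 1 := by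
  rw [Subgroup.mem_centralizer_singleton_iff, Matrix.SpecialLinearGroup.ext_iff]
  have hw : ((wS p : Matrix.SpecialLinearGroup (Fin 2) (ZMod p)) :
    Matrix (Fin 2) (Fin 2) (ZMod p)) = !![0, 1; -1, 0] := rfl
  simp only [Matrix.SpecialLinearGroup.coe_mul, hw, Fin.forall_fin_two,
    Matrix.mul_apply, Fin.sum_univ_two]
  simp
  grind

theorem eq_rotation_of_mem_centralizer_wS {g : Matrix.SpecialLinearGroup (Fin 2) (ZMod p)}
    (hg : g ∈ Subgroup.centralizer {wS p}) :
    (g : Matrix (Fin 2) (Fin 2) (ZMod p)) = !![g 0 0, g 0 1; -g 0 1, g 0 0] ∧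
      g 0 0 ^ 2 + g 0 1 ^ 2 = 1 := by
  obtain ⟨h1, h2⟩ := (mem_centralizer_wS_iff g).1 hg
  refine ⟨?_, ?_⟩
  · refine (Matrix.eta_fin_two _).trans ?_
    rw [h1, h2]
  · have hdet := g.det_coe
    rw [Matrix.det_fin_two, h1, h2] at hdet
    linear_combination hdet

theorem eq_zero_of_sq_add_sq_eq_zero (hp3 : p % 4 = 3) {x y : ZMod p} (h : x ^ 2 + y ^ 2 = 0) :
    x = 0 ∧ y = 0 := by
  have hns : ¬ IsSquare (-1 : ZMod p) := fun hs ↦ ZMod.exists_sq_eq_neg_one_iff.1 hs hp3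
  have hy : y = 0 := by
    by_contra hy
    exact hns ⟨x / y, by field_simp; linear_combination -h⟩
  subst hy
  simpa using h

theorem exists_mem_centralizer_wS_reflecting (hp3 : p % 4 = 3) (v : ZMod p × ZMod p) :
    ∃ g ∈ Subgroup.centralizer {wS p},
      matVec (g : Matrix (Fin 2) (Fin 2) (ZMod p)) v = (-v.1, v.2) := by
  by_cases hv : v.1 ^ 2 + v.2 ^ 2 = 0
  · obtain ⟨h1, h2⟩ := eq_zero_of_sq_add_sq_eq_zero hp3 hv
    exact ⟨1, one_mem _, by ext <;> simp [matVec, h1, h2]⟩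
  · obtain ⟨a, ha⟩ : ∃ a, a = (v.2 ^ 2 - v.1 ^ 2) / (v.1 ^ 2 + v.2 ^ 2) := ⟨_, rfl⟩
    obtain ⟨b, hb⟩ : ∃ b, b = -2 * v.1 * v.2 / (v.1 ^ 2 + v.2 ^ 2) := ⟨_, rfl⟩
    have hab : a * a + b * b = 1 := by
      rw [ha, hb]; field_simp; ring
    let g : Matrix.SpecialLinearGroup (Fin 2) (ZMod p) :=
      ⟨!![a, b; -b, a], by simp [Matrix.det_fin_two_of, hab]⟩
    refine ⟨g, (mem_centralizer_wS_iff g).2 ⟨rfl, rfl⟩, Prod.ext ?_ ?_⟩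
    · change a * v.1 + b * v.2 = -v.1
      rw [ha, hb]; field_simp; ring
    · change -b * v.1 + a * v.2 = v.2
      rw [ha, hb]; field_simp; ring

theorem det_rotation_sub_one {a b : ZMod p} (hab : a ^ 2 + b ^ 2 = 1) :
    (!![a, b; -b, a] - 1 : Matrix (Fin 2) (Fin 2) (ZMod p)).det = 2 * (1 - a) := by
  simp [Matrix.det_fin_two]
  linear_combination hab

theorem cayley_rotation {a b : ZMod p} (h2 : (2 : ZMod p) ≠ 0) (hab : a ^ 2 + b ^ 2 = 1)
    (ha : 1 - a ≠ 0) :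
    cayley !![a, b; -b, a] = !![0, -b / (1 - a); b / (1 - a), 0] := by
  have hu : IsUnit (!![a, b; -b, a] - 1 : Matrix (Fin 2) (Fin 2) (ZMod p)).det := by
    rw [det_rotation_sub_one hab]; exact (mul_ne_zero h2 ha).isUnit
  have hmul : (!![a, b; -b, a] + 1 : Matrix (Fin 2) (Fin 2) (ZMod p))
      = !![0, -b / (1 - a); b / (1 - a), 0] * (!![a, b; -b, a] - 1) := by
    ext i j
    fin_cases i <;> fin_cases j <;> simp [Matrix.mul_apply, Fin.sum_univ_two] <;> field_simp <;>
      first | ring1 | linear_combination -hab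
  rw [cayley, hmul, Matrix.mul_nonsing_inv_cancel_right _ _ hu]

theorem sgm_ne_zero {a : ZMod p} (ha : a ≠ 0) : sgm p a ≠ 0 := by
  rw [sgm, if_neg ha]
  split_ifs <;> simp

theorem exists_weilOp_rotation_eq_smul (hp3 : p % 4 = 3) (h2 : (2 : ZMod p) ≠ 0) {a b : ZMod p}
    (hab : a ^ 2 + b ^ 2 = 1) (ha : 1 - a ≠ 0) :
    ∃ k : ℂ, k ≠ 0 ∧
      weilOp p !![a, b; -b, a] = k • gaussOp p ((4 : ZMod p)⁻¹ * (-b / (1 - a))) := by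
  refine ⟨(p : ℂ)⁻¹ * sgm p (-((cayley !![a, b; -b, a] + 1).det)), mul_ne_zero ?_ ?_, ?_⟩
  · exact inv_ne_zero (Nat.cast_ne_zero.2 (Fact.out : p.Prime).ne_zero)
  · refine sgm_ne_zero (neg_ne_zero.2 fun h ↦ ?_)
    rw [cayley_rotation h2 hab ha, Matrix.det_fin_two] at h
    have h' : (b / (1 - a)) ^ 2 + 1 ^ 2 = 0 := by
      rw [← h]; simp; ring
    exact one_ne_zero (eq_zero_of_sq_add_sq_eq_zero hp3 h').2
  · rw [weilOp, gaussOp, smul_smul]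
    congr 1
    refine Finset.sum_congr rfl fun v _ ↦ ?_
    rw [cayley_rotation h2 hab ha]
    congr 2
    simp [omg, matVec]
    ring

theorem gaussOp_mul_heis_rotation (h2 : (2 : ZMod p) ≠ 0) {a b : ZMod p}
    (hab : a ^ 2 + b ^ 2 = 1) (ha : 1 - a ≠ 0) (v : ZMod p × ZMod p) :
    gaussOp p ((4 : ZMod p)⁻¹ * (-b / (1 - a))) * heis p (v, 0)
      = heis p (matVec !![a, b; -b, a] v, 0) * gaussOp p ((4 : ZMod p)⁻¹ * (-b / (1 - a))) := by
  refine gaussOp_mul_heis h2 fun y ↦ ?_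
  have h4 : (4 : ZMod p) = 2 * 2 := by norm_num
  rw [h4]
  simp [omg, matVec]
  field_simp
  linear_combination (b * (v.1 ^ 2 + v.2 ^ 2) - 2 * y.1 * v.2 + 2 * y.2 * v.1) * hab

end Torus

section SimpleSpectrum

variable {p : ℕ} [Fact p.Prime]

theorem pow_mul_heis {A : Module.End ℂ (ZMod p → ℂ)} {m : Matrix (Fin 2) (Fin 2) (ZMod p)}
    (hA : ∀ v, A * heis p (v, 0) = heis p (matVec m v, 0) * A) (n : ℕ) (v : ZMod p × ZMod p) :
    A ^ n * heis p (v, 0) = heis p (matVec (m ^ n) v, 0) * A ^ n := by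
  induction n generalizing v with
  | zero => simp [matVec_one]
  | succ n ih => rw [pow_succ, mul_assoc, hA, ← mul_assoc, ih, mul_assoc, pow_succ, matVec_mul]

theorem iSup_eigenspace_eq_top_of_intertwine {A : Module.End ℂ (ZMod p → ℂ)} (hA0 : A ≠ 0)
    {t : Matrix.SpecialLinearGroup (Fin 2) (ZMod p)}
    (hA : ∀ v, A * heis p (v, 0) = heis p (matVec t v, 0) * A) :
    ⨆ μ : ℂ, Module.End.eigenspace A μ = ⊤ := by
  have hN : 0 < orderOf t := orderOf_pos t
  obtain ⟨c, hc⟩ := eq_smul_one_of_commute_heis (A ^ orderOf t) fun v ↦ by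
    rw [commute_iff_eq, pow_mul_heis hA, ← Matrix.SpecialLinearGroup.coe_pow, pow_orderOf_eq_one,
      Matrix.SpecialLinearGroup.coe_one, matVec_one]
  have hinj : Function.Injective A :=
    (injective_iff_map_eq_zero A).2 fun _ ↦ injective_of_intertwine hA0 hA
  have hc0 : c ≠ 0 := by
    rintro rfl
    have h := hinj.iterate (orderOf t)
    rw [← Module.End.coe_pow, hc, zero_smul] at h
    exact one_ne_zero (h (a₁ := 1) (a₂ := 0) (by simp))
  have hss : A.IsSemisimple := by
    refine Module.End.isSemisimple_of_squarefree_aeval_eq_zero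
      (p := Polynomial.X ^ orderOf t - Polynomial.C c) ?_ ?_
    · exact (Polynomial.separable_X_pow_sub_C c (Nat.cast_ne_zero.2 hN.ne') hc0).squarefree
    · simp [hc, Algebra.algebraMap_eq_smul_one]
  rw [← Module.End.iSup_maxGenEigenspace_eq_top A]
  exact iSup_congr fun μ ↦ (hss.isFinitelySemisimple.maxGenEigenspace_eq_eigenspace μ).symm

theorem finrank_eigenspace_le_one_of_intertwine (hp3 : p % 4 = 3) (h2 : (2 : ZMod p) ≠ 0)
    {A : Module.End ℂ (ZMod p → ℂ)} (hA0 : A ≠ 0) (hsymm : ∀ f g, g ⬝ᵥ A f = A g ⬝ᵥ f)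
    {t : Matrix.SpecialLinearGroup (Fin 2) (ZMod p)}
    (hA : ∀ v, A * heis p (v, 0) = heis p (matVec t v, 0) * A)
    (hgen : ∀ g ∈ Subgroup.centralizer {wS p}, g ∈ Subgroup.zpowers t) (μ : ℂ) :
    Module.finrank ℂ (Module.End.eigenspace A μ) ≤ 1 := by
  by_cases hbot : Module.End.eigenspace A μ = ⊥
  · rw [hbot, finrank_bot]
    exact zero_le_one
  obtain ⟨f, hf, hf0⟩ := Submodule.exists_mem_ne_zero_of_ne_bot hbot
  have hf' := Module.End.mem_eigenspace_iff.1 hf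
  have hμ : μ ≠ 0 := by
    rintro rfl
    exact hf0 (injective_of_intertwine hA0 hA (by simpa using hf'))
  obtain ⟨x₀, hx₀⟩ := Function.ne_iff.1 hf0
  refine finrank_le_one ⟨f, hf⟩ fun ⟨g, hg⟩ ↦ ⟨g x₀ / f x₀, Subtype.ext ?_⟩
  have hg' := Module.End.mem_eigenspace_iff.1 hg
  have hinv : ∀ v, g ⬝ᵥ heis p (matVec t v, 0) f = g ⬝ᵥ heis p (v, 0) f := by
    intro v
    refine mul_left_cancel₀ hμ ?_
    calc μ * (g ⬝ᵥ heis p (matVec t v, 0) f) = g ⬝ᵥ heis p (matVec t v, 0) (A f) := by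
          rw [hf', map_smul, dotProduct_smul, smul_eq_mul]
      _ = g ⬝ᵥ A (heis p (v, 0) f) := by
          rw [← Module.End.mul_apply, ← hA, Module.End.mul_apply]
      _ = μ * (g ⬝ᵥ heis p (v, 0) f) := by
          rw [hsymm, hg', smul_dotProduct, smul_eq_mul]
  have hpow : ∀ (n : ℕ) v, g ⬝ᵥ heis p (matVec (t ^ n : Matrix.SpecialLinearGroup _ _) v, 0) f
      = g ⬝ᵥ heis p (v, 0) f := by
    intro n
    induction n with
    | zero => simp [matVec_one]
    | succ n ih =>
      intro v
      rw [pow_succ, Matrix.SpecialLinearGroup.coe_mul, matVec_mul, ih, hinv]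
  have hswap : ∀ v, g ⬝ᵥ heis p (v, 0) f = f ⬝ᵥ heis p (v, 0) g := by
    intro v
    obtain ⟨r, hr, hrv⟩ := exists_mem_centralizer_wS_reflecting hp3 v
    obtain ⟨n, rfl⟩ := mem_powers_iff_mem_zpowers.2 (hgen r hr)
    rw [dotProduct_heis h2 v g f, ← hrv]
    exact (hpow n v).symm.trans (dotProduct_comm _ _)
  funext x
  have h := mul_eq_mul_of_dotProduct_heis hswap x₀ x
  simp only [SetLike.mk_smul_mk, Pi.smul_apply, smul_eq_mul]
  have hx₀' : f x₀ ≠ 0 := hx₀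
  field_simp
  linear_combination h

end SimpleSpectrum

/-- For `p ≡ 3 (mod 4)` and `t` a generator of the (non-split) centralizer torus of the
Weyl element, the operator `ρ(t)` is defined by the kernel formula and has `p` distinct
eigenvalues: its eigenspaces are one-dimensional and they span. -/
theorem stmt15 (p : ℕ) [Fact p.Prime] (hp3 : p % 4 = 3)
    (t : Matrix.SpecialLinearGroup (Fin 2) (ZMod p))
    (ht : t ∈ Subgroup.centralizer {wS p})
    (hgen : ∀ g ∈ Subgroup.centralizer {wS p}, g ∈ Subgroup.zpowers t) :
    ((t : Matrix (Fin 2) (Fin 2) (ZMod p)) - 1).det ≠ 0 ∧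
    (∀ μ : ℂ, Module.finrank ℂ
      (Module.End.eigenspace
        (weilOp p (t : Matrix (Fin 2) (Fin 2) (ZMod p)) : Module.End ℂ (ZMod p → ℂ)) μ) ≤ 1) ∧
    (⨆ μ : ℂ, Module.End.eigenspace
      (weilOp p (t : Matrix (Fin 2) (Fin 2) (ZMod p)) : Module.End ℂ (ZMod p → ℂ)) μ) = ⊤ := by
  obtain ⟨hrot, hab⟩ := eq_rotation_of_mem_centralizer_wS ht
  have h2 : (2 : ZMod p) ≠ 0 := Ring.two_ne_zero (by rw [ZMod.ringChar_zmod_n]; omega)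
  have ha : 1 - t 0 0 ≠ 0 := by
    intro h
    have ha1 : t 0 0 = 1 := by linear_combination -h
    have hb0 : t 0 1 = 0 := by simpa [ha1] using hab
    have ht1 : t = 1 := by
      refine Subtype.ext ?_
      rw [hrot, ha1, hb0, neg_zero]
      exact Matrix.one_fin_two.symm
    have hw := hgen (wS p) ((mem_centralizer_wS_iff _).2 ⟨rfl, rfl⟩)
    rw [ht1, Subgroup.zpowers_one_eq_bot, Subgroup.mem_bot] at hw
    have h01 : (wS p) 0 1 = (1 : Matrix.SpecialLinearGroup (Fin 2) (ZMod p)) 0 1 := by rw [hw]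
    simp [wS] at h01
  obtain ⟨k, hk, hkA⟩ := exists_weilOp_rotation_eq_smul hp3 h2 hab ha
  rw [← hrot] at hkA
  have hA0 : weilOp p t ≠ 0 := by
    rw [hkA]
    exact smul_ne_zero hk (gaussOp_ne_zero _)
  have hA : ∀ v, weilOp p t * heis p (v, 0) = heis p (matVec t v, 0) * weilOp p t := by
    intro v
    have h := gaussOp_mul_heis_rotation h2 hab ha v
    rw [← hrot] at h
    rw [hkA, smul_mul_assoc, mul_smul_comm, h]
  have hsymm : ∀ f g, g ⬝ᵥ weilOp p t f = weilOp p t g ⬝ᵥ f := by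
    intro f g
    simp only [hkA, LinearMap.smul_apply, dotProduct_smul, smul_dotProduct, dotProduct_gaussOp h2]
  refine ⟨?_, finrank_eigenspace_le_one_of_intertwine hp3 h2 hA0 hsymm hA hgen,
    iSup_eigenspace_eq_top_of_intertwine hA0 hA⟩
  rw [hrot, det_rotation_sub_one hab]
  exact mul_ne_zero h2 ha

end DFTWeil
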